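/- Let d ≥ 1, K ≥ 1, τ > 0, S ≥ 0 and η ≥ 0. Let A, Ã : ℝ^d → (symmetric d×d real matrices) be measurable, both satisfying K^{-1}|ξ|² ≤ ⟨A(x)ξ, ξ⟩ ≤ K|ξ|² and ‖A(x) − A(y)‖ ≤ K|x−y| for all x,y,ξ (operator norms), and additionally ‖A(x) − Ã(x)‖ ≤ Kη for all x and ‖(A(z) − A(y)) − (Ã(z) − Ã(y))‖ ≤ K|z−y|η for all y,z. Let f : ℝ^d → [0,∞) be measurable and let b, b̃ : ℝ^d → ℝ^d be measurable with |b(y)| ≤ S f(y), |b̃(y)| ≤ S f(y), and |b(y) − b̃(y)| ≤ η f(y) for all y. Define H(y,z) := −⟨b(y), ∇_x p_{τA(z)}(x,z)|_{x=y}⟩ + ½ tr[ (A(z) − A(y)) · ∇²_x p_{τA(z)}(x,z)|_{x=y} ], and define H̃ analogously with (b̃, Ã) in place of (b, A). Then there exists a constant c > 0, depending only on d and K, such that for all y, z ∈ ℝ^d, |H(y,z) − H̃(y,z)| ≤ c (1 + S)(1 + f(y)) η τ^{-1/2} p̃^{2K,τ}(y,z). -/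

import Mathlib

open MeasureTheory Real Filter
open scoped ENNReal RealInnerProductSpace

noncomputable section

abbrev Ed (d : ℕ) := EuclideanSpace ℝ (Fin d)

/-- Gaussian reference kernel `p̃^{K,τ}(x,y) = (4Kπτ)^{-d/2} exp(-|y-x|²/(4Kτ))`. -/
def gaussK (d : ℕ) (K τ : ℝ) (x y : Ed d) : ℝ :=
  (4 * K * Real.pi * τ) ^ (-(d : ℝ) / 2) * Real.exp (-‖y - x‖ ^ 2 / (4 * K * τ))

/-- Gaussian density with covariance matrix `a`:
`p_a(x,y) = (2π)^{-d/2} (det a)^{-1/2} exp(-½⟨a⁻¹(y-x), y-x⟩)`. -/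
def pG (d : ℕ) (a : Matrix (Fin d) (Fin d) ℝ) (x y : Ed d) : ℝ :=
  (2 * Real.pi) ^ (-(d : ℝ) / 2) * a.det ^ (-(1 : ℝ) / 2) *
    Real.exp (-(1 / 2) * ⟪Matrix.toEuclideanLin a⁻¹ (y - x), y - x⟫)

/-- Operator norm of a matrix acting between Euclidean spaces. -/
def opN {d m : ℕ} (a : Matrix (Fin d) (Fin m) ℝ) : ℝ :=
  ‖LinearMap.toContinuousLinearMap (Matrix.toEuclideanLin a)‖

/-- `(K,τ)`-ellipticity: `(τ/K)|ξ|² ≤ ⟨aξ, ξ⟩ ≤ Kτ|ξ|²` for all `ξ`. -/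
def IsElliptic {d : ℕ} (K τ : ℝ) (a : Matrix (Fin d) (Fin d) ℝ) : Prop :=
  ∀ ξ : Ed d, (τ / K) * ‖ξ‖ ^ 2 ≤ ⟪Matrix.toEuclideanLin a ξ, ξ⟫ ∧
    ⟪Matrix.toEuclideanLin a ξ, ξ⟫ ≤ K * τ * ‖ξ‖ ^ 2

/-- Gradient `∇_x p_a(x,y)` of the Gaussian density in the first variable. -/
def gradP (d : ℕ) (a : Matrix (Fin d) (Fin d) ℝ) (y x : Ed d) : Ed d :=
  gradient (fun w => pG d a w y) x

/-- Hessian `∇²_x p_a(x,y)` (as a continuous linear map) of the Gaussian density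
in the first variable. -/
def hessP (d : ℕ) (a : Matrix (Fin d) (Fin d) ℝ) (y x : Ed d) : Ed d →L[ℝ] Ed d :=
  fderiv ℝ (gradP d a y) x

/-- Localized norm `‖g‖_{L̃_p^q([s,t])}` (valued in `ℝ≥0∞`). -/
def tnorm (d : ℕ) (p q s t : ℝ) (g : ℝ → Ed d → ℝ) : ℝ≥0∞ :=
  ⨆ z : Ed d, (∫⁻ u in Set.Icc s t,
    (∫⁻ x in Metric.closedBall z 1, ENNReal.ofReal (|g u x| ^ p)) ^ (q / p)) ^ (1 / q)

instance (d : ℕ) : MeasurableSpace (Matrix (Fin d) (Fin d) ℝ) :=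
  (inferInstance : MeasurableSpace (Fin d → Fin d → ℝ))

open Matrix (toEuclideanLin)

open scoped Matrix.Norms.L2Operator

section MatrixBounds

variable {d : ℕ}

lemma norm_toEuclideanLin_le (a : Matrix (Fin d) (Fin d) ℝ) (x : Ed d) :
    ‖toEuclideanLin a x‖ ≤ ‖a‖ * ‖x‖ :=
  (LinearMap.toContinuousLinearMap (toEuclideanLin a)).le_opNorm x

lemma norm_matrix_le_of_forall {a : Matrix (Fin d) (Fin d) ℝ} {C : ℝ} (hC : 0 ≤ C)
    (h : ∀ x : Ed d, ‖toEuclideanLin a x‖ ≤ C * ‖x‖) : ‖a‖ ≤ C :=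
  (LinearMap.toContinuousLinearMap (toEuclideanLin a)).opNorm_le_bound hC h

lemma toEuclideanLin_mul_apply (a b : Matrix (Fin d) (Fin d) ℝ) (x : Ed d) :
    toEuclideanLin (a * b) x = toEuclideanLin a (toEuclideanLin b x) := by
  simp [Matrix.toLpLin_apply, Matrix.mulVec_mulVec]

lemma toEuclideanLin_one_apply (x : Ed d) :
    toEuclideanLin (1 : Matrix (Fin d) (Fin d) ℝ) x = x := by
  simp

lemma inner_toEuclideanLin_comm {a : Matrix (Fin d) (Fin d) ℝ} (ha : a.IsSymm) (x y : Ed d) :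
    ⟪toEuclideanLin a x, y⟫ = ⟪x, toEuclideanLin a y⟫ := by
  have h : a.IsHermitian := by
    rw [Matrix.IsHermitian, Matrix.conjTranspose_eq_transpose_of_trivial]; exact ha
  exact Matrix.isSymmetric_toEuclideanLin_iff.mpr h x y

lemma abs_inner_toEuclideanLin_le (a : Matrix (Fin d) (Fin d) ℝ) (x y : Ed d) :
    |⟪toEuclideanLin a x, y⟫| ≤ ‖a‖ * ‖x‖ * ‖y‖ :=
  (abs_real_inner_le_norm _ _).trans
    (mul_le_mul_of_nonneg_right (norm_toEuclideanLin_le a x) (norm_nonneg y))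

lemma abs_trace_le (a : Matrix (Fin d) (Fin d) ℝ) : |a.trace| ≤ d * ‖a‖ := by
  have hentry : ∀ i, |a i i| ≤ ‖a‖ := fun i => by
    have h := abs_inner_toEuclideanLin_le a (EuclideanSpace.single i 1) (EuclideanSpace.single i 1)
    simpa [EuclideanSpace.inner_single_right, Matrix.toLpLin_apply] using h
  calc |a.trace| ≤ ∑ i, |a i i| := Finset.abs_sum_le_sum_abs _ _
    _ ≤ ∑ _i : Fin d, ‖a‖ := Finset.sum_le_sum fun i _ => hentry i
    _ = d * ‖a‖ := by simp

lemma exists_det_bound (d : ℕ) (R : ℝ) : ∃ C : ℝ, 1 ≤ C ∧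
    ∀ a b : Matrix (Fin d) (Fin d) ℝ, ‖a‖ ≤ R → ‖b‖ ≤ R →
      |a.det| ≤ C ∧ |a.det - b.det| ≤ C * ‖a - b‖ := by
  have hdiff : ContDiff ℝ 1 (fun a : Matrix (Fin d) (Fin d) ℝ => a.det) := by
    simp only [Matrix.det_apply]
    refine ContDiff.sum fun σ _ => ContDiff.const_smul _ (contDiff_prod fun i _ => ?_)
    exact (LinearMap.toContinuousLinearMap (Matrix.entryLinearMap ℝ ℝ (σ i) i)).contDiff
  have hcpt : IsCompact (Metric.closedBall (0 : Matrix (Fin d) (Fin d) ℝ) R) :=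
    isCompact_closedBall _ _
  obtain ⟨L, hL⟩ := (hdiff.locallyLipschitz.locallyLipschitzOn
    (s := Metric.closedBall 0 R)).exists_lipschitzOnWith_of_compact hcpt
  obtain ⟨B, hB⟩ := hcpt.exists_bound_of_continuousOn hdiff.continuous.continuousOn
  refine ⟨max 1 (max B L), le_max_left _ _, fun a b ha hb => ⟨?_, ?_⟩⟩
  · exact (hB a (by simpa using ha)).trans ((le_max_left _ _).trans (le_max_right _ _))
  · refine (hL.norm_sub_le (by simpa using ha) (by simpa using hb)).trans ?_
    exact mul_le_mul_of_nonneg_right ((le_max_right _ _).trans (le_max_right _ _)) (norm_nonneg _)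

variable {K : ℝ} {a : Matrix (Fin d) (Fin d) ℝ}

lemma sq_norm_toEuclideanLin_le (hK : 0 < K) (hs : a.IsSymm)
    (h : ∀ ξ : Ed d, 0 ≤ ⟪toEuclideanLin a ξ, ξ⟫ ∧ ⟪toEuclideanLin a ξ, ξ⟫ ≤ K * ‖ξ‖ ^ 2)
    (ξ : Ed d) : ‖toEuclideanLin a ξ‖ ^ 2 ≤ K * ⟪toEuclideanLin a ξ, ξ⟫ := by
  have h1 := (h (ξ - K⁻¹ • toEuclideanLin a ξ)).1
  have h2 := (h (toEuclideanLin a ξ)).2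
  rw [map_sub, map_smul, inner_sub_left, inner_sub_right, inner_sub_right, inner_smul_left,
    inner_smul_left, inner_smul_right, inner_smul_right,
    inner_toEuclideanLin_comm hs (toEuclideanLin a ξ) ξ, real_inner_self_eq_norm_sq] at h1
  simp only [conj_trivial] at h1
  have h3 : K⁻¹ * (K⁻¹ * ⟪toEuclideanLin a (toEuclideanLin a ξ), toEuclideanLin a ξ⟫) ≤
      K⁻¹ * ‖toEuclideanLin a ξ‖ ^ 2 := by
    have := mul_le_mul_of_nonneg_left h2 (by positivity : 0 ≤ K⁻¹ * K⁻¹)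
    calc _ = _ := by ring
      _ ≤ _ := this
      _ = _ := by field_simp
  have h4 : K⁻¹ * ‖toEuclideanLin a ξ‖ ^ 2 ≤ ⟪toEuclideanLin a ξ, ξ⟫ := by linarith
  rwa [inv_mul_le_iff₀ hK] at h4

/-- Quantitative ellipticity of the inverse of a symmetric elliptic matrix. -/
lemma inverse_elliptic (hK : 0 < K) (hs : a.IsSymm)
    (h : ∀ ξ : Ed d, K⁻¹ * ‖ξ‖ ^ 2 ≤ ⟪toEuclideanLin a ξ, ξ⟫ ∧
      ⟪toEuclideanLin a ξ, ξ⟫ ≤ K * ‖ξ‖ ^ 2) :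
    0 < a.det ∧ ‖a‖ ≤ K ∧ ‖a⁻¹‖ ≤ K ∧
      ∀ ξ : Ed d, K⁻¹ * ‖ξ‖ ^ 2 ≤ ⟪toEuclideanLin a⁻¹ ξ, ξ⟫ := by
  have hdet : 0 < a.det := by
    refine Matrix.PosDef.det_pos (Matrix.PosDef.of_dotProduct_mulVec_pos ?_ fun x hx => ?_)
    · rw [Matrix.IsHermitian, Matrix.conjTranspose_eq_transpose_of_trivial]; exact hs
    · have h0 : (WithLp.toLp 2 x : Ed d) ≠ 0 := by simpa using hx
      have h1 := (h (WithLp.toLp 2 x)).1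
      have h2 : 0 < K⁻¹ * ‖(WithLp.toLp 2 x : Ed d)‖ ^ 2 := by positivity
      have h3 : ⟪toEuclideanLin a (WithLp.toLp 2 x), WithLp.toLp 2 x⟫ = star x ⬝ᵥ a.mulVec x := by
        simp [Matrix.toLpLin_apply, EuclideanSpace.inner_eq_star_dotProduct]
      linarith
  have hu : IsUnit a.det := hdet.ne'.isUnit
  have hsq := sq_norm_toEuclideanLin_le hK hs fun ξ =>
    ⟨(by positivity : 0 ≤ K⁻¹ * ‖ξ‖ ^ 2).trans (h ξ).1, (h ξ).2⟩
  have hcancel : ∀ ξ : Ed d, toEuclideanLin a (toEuclideanLin a⁻¹ ξ) = ξ := fun ξ => by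
    rw [← toEuclideanLin_mul_apply, Matrix.mul_nonsing_inv _ hu, toEuclideanLin_one_apply]
  refine ⟨hdet, norm_matrix_le_of_forall hK.le fun ξ => ?_,
    norm_matrix_le_of_forall hK.le fun ξ => ?_, fun ξ => ?_⟩
  · have h1 := hsq ξ
    have h2 := real_inner_le_norm (toEuclideanLin a ξ) ξ
    by_contra! h3
    have h4 : 0 < ‖toEuclideanLin a ξ‖ := lt_of_le_of_lt (by positivity) h3
    nlinarith
  · have h1 := (h (toEuclideanLin a⁻¹ ξ)).1
    rw [hcancel] at h1
    have h2 := real_inner_le_norm ξ (toEuclideanLin a⁻¹ ξ)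
    rw [inv_mul_le_iff₀ hK] at h1
    by_contra! h3
    have h4 : 0 < ‖toEuclideanLin a⁻¹ ξ‖ := lt_of_le_of_lt (by positivity) h3
    nlinarith
  · have h1 := hsq (toEuclideanLin a⁻¹ ξ)
    rw [hcancel, real_inner_comm] at h1
    rwa [inv_mul_le_iff₀ hK]

lemma norm_inv_sub_inv_le {a' : Matrix (Fin d) (Fin d) ℝ} (hK : 0 ≤ K) (hu : 0 < a.det)
    (hu' : 0 < a'.det) (h : ‖a⁻¹‖ ≤ K) (h' : ‖a'⁻¹‖ ≤ K) :
    ‖a⁻¹ - a'⁻¹‖ ≤ K ^ 2 * ‖a - a'‖ := by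
  have key : a⁻¹ - a'⁻¹ = a⁻¹ * (a' - a) * a'⁻¹ := by
    rw [mul_sub, sub_mul, Matrix.nonsing_inv_mul _ hu.ne'.isUnit, mul_assoc,
      Matrix.mul_nonsing_inv _ hu'.ne'.isUnit, mul_one, one_mul]
  calc ‖a⁻¹ - a'⁻¹‖ ≤ ‖a⁻¹‖ * ‖a' - a‖ * ‖a'⁻¹‖ := by
        rw [key]; exact (norm_mul_le _ _).trans (by gcongr; exact norm_mul_le _ _)
    _ ≤ K * ‖a' - a‖ * K := by gcongr
    _ = K ^ 2 * ‖a - a'‖ := by rw [norm_sub_rev]; ring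

end MatrixBounds

section Kernel

variable {d : ℕ}

lemma hasGradientAt_pG {a : Matrix (Fin d) (Fin d) ℝ} (hs : a⁻¹.IsSymm) (y x : Ed d) :
    HasGradientAt (fun w => pG d a w y) (pG d a x y • toEuclideanLin a⁻¹ (y - x)) x := by
  set T : Ed d →L[ℝ] Ed d := LinearMap.toContinuousLinearMap (toEuclideanLin a⁻¹)
  have hsub : HasFDerivAt (fun w : Ed d => y - w) (-ContinuousLinearMap.id ℝ (Ed d)) x :=
    (hasFDerivAt_id x).const_sub y
  have hT : HasFDerivAt (fun w : Ed d => T (y - w)) (T.comp (-ContinuousLinearMap.id ℝ (Ed d))) x :=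
    T.hasFDerivAt.comp x hsub
  have h := (((hT.inner ℝ hsub).const_mul (-(1 / 2))).exp).const_mul
    ((2 * Real.pi) ^ (-(d : ℝ) / 2) * a.det ^ (-(1 : ℝ) / 2))
  rw [hasGradientAt_iff_hasFDerivAt]
  refine h.congr_fderiv ?_
  ext ξ
  have hsymm : ⟪T ξ, y - x⟫ = ⟪T (y - x), ξ⟫ := by
    rw [real_inner_comm]; exact (inner_toEuclideanLin_comm hs _ _).symm
  simp only [pG, InnerProductSpace.toDual_apply_apply, inner_smul_left, conj_trivial]
  simp only [smul_apply, ContinuousLinearMap.comp_apply,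
    fderivInnerCLM_apply, ContinuousLinearMap.prod_apply, neg_apply,
    ContinuousLinearMap.id_apply, map_neg, inner_neg_left, inner_neg_right, hsymm, smul_eq_mul]
  change _ = _ * Real.exp (-(1 / 2) * ⟪T (y - x), y - x⟫) * ⟪T (y - x), ξ⟫
  ring

lemma gradP_eq {a : Matrix (Fin d) (Fin d) ℝ} (hs : a⁻¹.IsSymm) (y x : Ed d) :
    gradP d a y x = pG d a x y • toEuclideanLin a⁻¹ (y - x) :=
  (hasGradientAt_pG hs y x).gradient

lemma hessP_apply {a : Matrix (Fin d) (Fin d) ℝ} (hs : a⁻¹.IsSymm) (y x ξ : Ed d) :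
    hessP d a y x ξ = pG d a x y •
      (⟪toEuclideanLin a⁻¹ (y - x), ξ⟫ • toEuclideanLin a⁻¹ (y - x) - toEuclideanLin a⁻¹ ξ) := by
  set T : Ed d →L[ℝ] Ed d := LinearMap.toContinuousLinearMap (toEuclideanLin a⁻¹)
  have hTapp : ∀ w, toEuclideanLin a⁻¹ w = T w := fun _ => rfl
  have hT : HasFDerivAt (fun w : Ed d => T (y - w)) (T.comp (-ContinuousLinearMap.id ℝ (Ed d))) x :=
    T.hasFDerivAt.comp x ((hasFDerivAt_id x).const_sub y)
  have hg : gradP d a y = fun w => pG d a w y • T (y - w) := funext fun w => gradP_eq hs y w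
  rw [hessP, hg, ((hasGradientAt_pG hs y x).hasFDerivAt.fun_smul hT).fderiv]
  simp only [add_apply, smul_apply,
    ContinuousLinearMap.comp_apply, neg_apply, ContinuousLinearMap.id_apply,
    map_neg, ContinuousLinearMap.smulRight_apply, InnerProductSpace.toDual_apply_apply,
    inner_smul_left, conj_trivial, hTapp]
  module

lemma trace_mul_hessP {a : Matrix (Fin d) (Fin d) ℝ} (hs : a⁻¹.IsSymm)
    (M : Matrix (Fin d) (Fin d) ℝ) (y x : Ed d) :
    Matrix.trace (M * Matrix.of (fun i j => hessP d a y x (EuclideanSpace.single j (1 : ℝ)) i)) =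
      pG d a x y * (⟪toEuclideanLin M (toEuclideanLin a⁻¹ (y - x)), toEuclideanLin a⁻¹ (y - x)⟫ -
        (M * a⁻¹).trace) := by
  set u := toEuclideanLin a⁻¹ (y - x) with hu
  have h : Matrix.of (fun i j => hessP d a y x (EuclideanSpace.single j (1 : ℝ)) i) =
      pG d a x y • (Matrix.vecMulVec u.ofLp u.ofLp - a⁻¹) := by
    ext i j
    simp [hessP_apply hs, ← hu, EuclideanSpace.inner_single_right, Matrix.toLpLin_apply,
      Matrix.vecMulVec_apply, mul_comm]
  rw [h, Matrix.mul_smul, Matrix.trace_smul, mul_sub, Matrix.trace_sub, smul_eq_mul,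
    Matrix.mul_vecMulVec, Matrix.trace_vecMulVec]
  congr 2
  simp [Matrix.toLpLin_apply, EuclideanSpace.inner_eq_star_dotProduct, dotProduct_comm]

end Kernel

section ScaledKernel

variable {d : ℕ}

/-- The Gaussian factor `(det a)^{-1/2} exp(-½⟨a⁻¹v, v⟩)`. -/
def gaussFactor (a : Matrix (Fin d) (Fin d) ℝ) (v : Ed d) : ℝ :=
  √(a⁻¹.det) * Real.exp (-(1 / 2 * ⟪toEuclideanLin a⁻¹ v, v⟫))

/-- The polynomial factor of the correction kernel at the rescaled point `v`. -/
def correctionFactor (a M : Matrix (Fin d) (Fin d) ℝ) (b v : Ed d) : ℝ :=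
  -⟪b, toEuclideanLin a⁻¹ v⟫ +
    1 / 2 * (⟪toEuclideanLin M (toEuclideanLin a⁻¹ v), toEuclideanLin a⁻¹ v⟫ -
      (M * a⁻¹).trace)

lemma inv_smul_matrix {τ : ℝ} (hτ : τ ≠ 0) {a : Matrix (Fin d) (Fin d) ℝ} (ha : a.det ≠ 0) :
    (τ • a)⁻¹ = τ⁻¹ • a⁻¹ := by
  refine Matrix.inv_eq_left_inv ?_
  rw [Matrix.smul_mul, Matrix.mul_smul, Matrix.nonsing_inv_mul _ ha.isUnit, smul_smul,
    inv_mul_cancel₀ hτ, one_smul]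

lemma pG_smul {τ : ℝ} (hτ : 0 < τ) {a : Matrix (Fin d) (Fin d) ℝ} (ha : 0 < a.det)
    (y z : Ed d) :
    pG d (τ • a) y z =
      (2 * Real.pi * τ) ^ (-(d : ℝ) / 2) * gaussFactor a ((√τ)⁻¹ • (z - y)) := by
  have hdet : (τ • a).det ^ (-(1 : ℝ) / 2) = τ ^ (-(d : ℝ) / 2) * √(a⁻¹.det) := by
    rw [Matrix.det_smul, Fintype.card_fin, Real.mul_rpow (by positivity) ha.le,
      ← Real.rpow_natCast, ← Real.rpow_mul hτ.le, Matrix.det_nonsing_inv,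
      Ring.inverse_eq_inv', Real.sqrt_inv, Real.sqrt_eq_rpow, ← Real.rpow_neg ha.le]
    congr 2 <;> ring
  have hinner : -(1 / 2) * ⟪toEuclideanLin (τ • a)⁻¹ (z - y), z - y⟫ =
      -(1 / 2 * ⟪toEuclideanLin a⁻¹ ((√τ)⁻¹ • (z - y)), (√τ)⁻¹ • (z - y)⟫) := by
    rw [inv_smul_matrix hτ.ne' ha.ne', map_smul, LinearMap.smul_apply, map_smul,
      inner_smul_left, inner_smul_left, inner_smul_right, ← mul_assoc ((starRingEnd ℝ) (√τ)⁻¹)]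
    simp only [conj_trivial]
    rw [← mul_inv, Real.mul_self_sqrt hτ.le]
    ring
  rw [pG, gaussFactor, hdet, hinner, Real.mul_rpow (by positivity) hτ.le]
  ring

lemma correction_kernel_eq {τ : ℝ} (hτ : 0 < τ) {a : Matrix (Fin d) (Fin d) ℝ} (hs : a.IsSymm)
    (ha : 0 < a.det) (M : Matrix (Fin d) (Fin d) ℝ) (b y z : Ed d) :
    -⟪b, gradP d (τ • a) z y⟫ + (1 / 2) * Matrix.trace (M * Matrix.of (fun i j =>
        hessP d (τ • a) z y (EuclideanSpace.single j (1 : ℝ)) i)) =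
      (2 * Real.pi * τ) ^ (-(d : ℝ) / 2) * τ ^ (-(1 : ℝ) / 2) *
        (gaussFactor a ((√τ)⁻¹ • (z - y)) *
          correctionFactor a ((√τ)⁻¹ • M) b ((√τ)⁻¹ • (z - y))) := by
  have hsymm : (τ • a)⁻¹.IsSymm := by
    rw [Matrix.IsSymm, Matrix.transpose_nonsing_inv, Matrix.transpose_smul, hs.eq]
  have hpow : τ ^ (-(1 : ℝ) / 2) = (√τ)⁻¹ := by
    rw [Real.sqrt_eq_rpow, ← Real.rpow_neg hτ.le]; congr 1; ring
  have hinv : τ⁻¹ = (√τ)⁻¹ * (√τ)⁻¹ := by rw [← mul_inv, Real.mul_self_sqrt hτ.le]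
  rw [gradP_eq hsymm, trace_mul_hessP hsymm, pG_smul hτ ha, inv_smul_matrix hτ.ne' ha.ne', hpow,
    correctionFactor, hinv]
  simp only [map_smul, LinearMap.smul_apply, inner_smul_left, inner_smul_right, conj_trivial,
    Matrix.mul_smul, Matrix.smul_mul, Matrix.trace_smul, smul_eq_mul]
  ring

lemma abs_exp_neg_sub_exp_neg_le {m s t : ℝ} (hs : m ≤ s) (ht : m ≤ t) :
    |Real.exp (-s) - Real.exp (-t)| ≤ |s - t| * Real.exp (-m) := by
  have key : ∀ s t : ℝ, m ≤ s → Real.exp (-s) - Real.exp (-t) ≤ |s - t| * Real.exp (-m) := by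
    intro s t hs
    have h1 : s - t + 1 ≤ Real.exp (s - t) := Real.add_one_le_exp _
    have h2 : Real.exp (-t) = Real.exp (-s) * Real.exp (s - t) := by
      rw [← Real.exp_add]; congr 1; ring
    calc Real.exp (-s) - Real.exp (-t) ≤ -(s - t) * Real.exp (-s) := by
          rw [h2]; nlinarith [Real.exp_pos (-s)]
      _ ≤ |s - t| * Real.exp (-m) :=
          mul_le_mul (neg_le_abs _) (Real.exp_le_exp.mpr (by linarith)) (Real.exp_pos _).le
            (abs_nonneg _)
  rw [abs_sub_le_iff]
  exact ⟨key s t hs, by rw [abs_sub_comm]; exact key t s ht⟩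

lemma abs_sqrt_sub_sqrt_le {C x y : ℝ} (hC : 1 ≤ C) (hx : C⁻¹ ≤ x) (hy : 0 ≤ y) :
    |√x - √y| ≤ C * |x - y| := by
  have hC0 : 0 < C := by linarith
  have hx0 : 0 ≤ x := (inv_pos.mpr hC0).le.trans hx
  have h1 : C⁻¹ ≤ √x := by
    refine Real.le_sqrt_of_sq_le (le_trans ?_ hx)
    have := inv_le_one_of_one_le₀ hC
    nlinarith [inv_pos.mpr hC0]
  have h2 : |x - y| = |√x - √y| * (√x + √y) := by
    rw [← abs_of_nonneg (by positivity : 0 ≤ √x + √y), ← abs_mul]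
    congr 1
    nlinarith [Real.sq_sqrt hx0, Real.sq_sqrt hy]
  have h3 : 1 ≤ C * (√x + √y) := by
    calc 1 = C * C⁻¹ := (mul_inv_cancel₀ hC0.ne').symm
      _ ≤ C * (√x + √y) := by gcongr; linarith [Real.sqrt_nonneg y]
  rw [h2]
  nlinarith [abs_nonneg (√x - √y)]

/-- Symmetric matrices with spectrum in `[K⁻¹, K]`. -/
def IsSymmElliptic (K : ℝ) (a : Matrix (Fin d) (Fin d) ℝ) : Prop :=
  a.IsSymm ∧ ∀ ξ : Ed d, K⁻¹ * ‖ξ‖ ^ 2 ≤ ⟪toEuclideanLin a ξ, ξ⟫ ∧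
    ⟪toEuclideanLin a ξ, ξ⟫ ≤ K * ‖ξ‖ ^ 2

lemma exists_gaussFactor_bound (d : ℕ) {K : ℝ} (hK : 1 ≤ K) : ∃ C : ℝ, 0 < C ∧
    ∀ (a a' : Matrix (Fin d) (Fin d) ℝ) (η : ℝ) (v : Ed d), IsSymmElliptic K a →
      IsSymmElliptic K a' → ‖a - a'‖ ≤ K * η →
      |gaussFactor a v| ≤ C * Real.exp (-(‖v‖ ^ 2 / (2 * K))) ∧
      |gaussFactor a v - gaussFactor a' v| ≤
        C * η * (1 + ‖v‖) ^ 2 * Real.exp (-(‖v‖ ^ 2 / (2 * K))) := by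
  have hK0 : 0 < K := by linarith
  obtain ⟨C, hC, hdet⟩ := exists_det_bound d K
  have hC0 : 0 < C := by linarith
  refine ⟨2 * C ^ 2 * K ^ 3, by positivity, fun a a' η v hell hell' hη => ?_⟩
  obtain ⟨ha, hna, hni, hlow⟩ := inverse_elliptic hK0 hell.1 hell.2
  obtain ⟨ha', hna', hni', hlow'⟩ := inverse_elliptic hK0 hell'.1 hell'.2
  have hη0 : 0 ≤ η := by
    have := (norm_nonneg _).trans hη
    exact nonneg_of_mul_nonneg_right this hK0
  have hG : ‖a⁻¹ - a'⁻¹‖ ≤ K ^ 3 * η := by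
    calc _ ≤ K ^ 2 * ‖a - a'‖ := norm_inv_sub_inv_le hK0.le ha ha' hni hni'
      _ ≤ K ^ 2 * (K * η) := by gcongr
      _ = K ^ 3 * η := by ring
  set g := Real.exp (-(‖v‖ ^ 2 / (2 * K))) with hg
  have hg0 : 0 < g := Real.exp_pos _
  have hform : ∀ G : Matrix (Fin d) (Fin d) ℝ,
      (∀ ξ : Ed d, K⁻¹ * ‖ξ‖ ^ 2 ≤ ⟪toEuclideanLin G ξ, ξ⟫) →
      ‖v‖ ^ 2 / (2 * K) ≤ 1 / 2 * ⟪toEuclideanLin G v, v⟫ := fun G h => by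
    have h1 := h v
    have h2 : ‖v‖ ^ 2 / (2 * K) = 1 / 2 * (K⁻¹ * ‖v‖ ^ 2) := by field_simp
    linarith
  have hs := hform _ hlow
  have hs' := hform _ hlow'
  have hsqrt : ∀ G : Matrix (Fin d) (Fin d) ℝ, ‖G‖ ≤ K → √G.det ≤ C := fun G h => by
    rw [Real.sqrt_le_left hC0.le]
    have := (abs_le.mp (hdet G G h h).1).2
    nlinarith
  have hdetlow : C⁻¹ ≤ a⁻¹.det := by
    rw [Matrix.det_nonsing_inv, Ring.inverse_eq_inv']
    exact inv_anti₀ ha (abs_le.mp (hdet a a hna hna).1).2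
  have hdet0' : 0 ≤ a'⁻¹.det := by
    rw [Matrix.det_nonsing_inv, Ring.inverse_eq_inv']; positivity
  have hD : |√(a⁻¹.det) - √(a'⁻¹.det)| ≤ C ^ 2 * K ^ 3 * η := by
    calc _ ≤ C * |a⁻¹.det - a'⁻¹.det| := abs_sqrt_sub_sqrt_le hC hdetlow hdet0'
      _ ≤ C * (C * (K ^ 3 * η)) := by
          gcongr
          exact (hdet _ _ hni hni').2.trans (by gcongr)
      _ = C ^ 2 * K ^ 3 * η := by ring
  have he : |Real.exp (-(1 / 2 * ⟪toEuclideanLin a⁻¹ v, v⟫)) -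
      Real.exp (-(1 / 2 * ⟪toEuclideanLin a'⁻¹ v, v⟫))| ≤ K ^ 3 * η * ‖v‖ ^ 2 * g := by
    refine (abs_exp_neg_sub_exp_neg_le hs hs').trans (mul_le_mul_of_nonneg_right ?_ hg0.le)
    have h1 := abs_inner_toEuclideanLin_le (a⁻¹ - a'⁻¹) v v
    rw [← mul_sub, ← inner_sub_left, ← LinearMap.sub_apply, ← map_sub, abs_mul]
    calc _ ≤ |(1 / 2 : ℝ)| * (K ^ 3 * η * ‖v‖ * ‖v‖) := by
          gcongr
          exact h1.trans (by gcongr)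
      _ ≤ 1 * (K ^ 3 * η * ‖v‖ * ‖v‖) := by
          gcongr
          norm_num [abs_of_pos]
      _ = _ := by ring
  have hexp : Real.exp (-(1 / 2 * ⟪toEuclideanLin a⁻¹ v, v⟫)) ≤ g :=
    Real.exp_le_exp.mpr (by linarith)
  have hK3 : 1 ≤ K ^ 3 := one_le_pow₀ hK
  constructor
  · rw [gaussFactor, abs_of_nonneg (by positivity)]
    have hCle : C ≤ 2 * C ^ 2 * K ^ 3 := by
      have : C * 1 ≤ C * (2 * C * K ^ 3) := by gcongr; nlinarith
      linarith
    exact mul_le_mul ((hsqrt _ hni).trans hCle) hexp (Real.exp_pos _).le (by positivity)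
  · have hsplit : gaussFactor a v - gaussFactor a' v =
        (√(a⁻¹.det) - √(a'⁻¹.det)) * Real.exp (-(1 / 2 * ⟪toEuclideanLin a⁻¹ v, v⟫)) +
        √(a'⁻¹.det) * (Real.exp (-(1 / 2 * ⟪toEuclideanLin a⁻¹ v, v⟫)) -
          Real.exp (-(1 / 2 * ⟪toEuclideanLin a'⁻¹ v, v⟫))) := by
      rw [gaussFactor, gaussFactor]; ring
    have hC2 : C ≤ C ^ 2 := by nlinarith
    rw [hsplit]
    calc _ ≤ C ^ 2 * K ^ 3 * η * g + C * (K ^ 3 * η * ‖v‖ ^ 2 * g) := by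
          refine (abs_add_le _ _).trans (add_le_add ?_ ?_)
          · rw [abs_mul, abs_of_pos (Real.exp_pos _)]
            exact mul_le_mul hD hexp (Real.exp_pos _).le (by positivity)
          · rw [abs_mul, abs_of_nonneg (Real.sqrt_nonneg _)]
            exact mul_le_mul (hsqrt _ hni') he (abs_nonneg _) hC0.le
      _ ≤ C ^ 2 * K ^ 3 * η * g * (1 + ‖v‖) ^ 2 + C ^ 2 * (K ^ 3 * η * (1 + ‖v‖) ^ 2 * g) := by
          have hv := norm_nonneg v
          refine add_le_add ?_ ?_
          · exact le_mul_of_one_le_right (by positivity) (one_le_pow₀ (by linarith))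
          · gcongr
            linarith
      _ = _ := by ring

lemma le_one_add_pow_three {r : ℝ} (hr : 0 ≤ r) : r ≤ (1 + r) ^ 3 := by
  nlinarith [pow_nonneg hr 3, pow_nonneg hr 2]

lemma abs_correctionFactor_le {K S f : ℝ} (hK : 0 ≤ K) (hS : 0 ≤ S) (hf : 0 ≤ f)
    {a M : Matrix (Fin d) (Fin d) ℝ} {b v : Ed d} (ha : ‖a⁻¹‖ ≤ K) (hM : ‖M‖ ≤ K * ‖v‖)
    (hb : ‖b‖ ≤ S * f) :
    |correctionFactor a M b v| ≤
      (K + K ^ 3 + d * K ^ 2) * (1 + ‖v‖) ^ 3 * ((1 + S) * (1 + f)) := by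
  set r := ‖v‖ with hr
  have hr0 : 0 ≤ r := norm_nonneg v
  have hu : ‖toEuclideanLin a⁻¹ v‖ ≤ K * r :=
    (norm_toEuclideanLin_le _ _).trans (by gcongr)
  have h1 : |⟪b, toEuclideanLin a⁻¹ v⟫| ≤ S * f * (K * r) :=
    (abs_real_inner_le_norm _ _).trans (by gcongr)
  have h2 : |⟪toEuclideanLin M (toEuclideanLin a⁻¹ v), toEuclideanLin a⁻¹ v⟫| ≤
      K * r * (K * r) * (K * r) :=
    (abs_inner_toEuclideanLin_le _ _ _).trans (by gcongr)
  have h3 : |(M * a⁻¹).trace| ≤ d * (K * r * K) :=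
    (abs_trace_le _).trans (by gcongr; exact (norm_mul_le _ _).trans (by gcongr))
  have hrle : r ≤ (1 + r) ^ 3 := le_one_add_pow_three hr0
  have hr3 : r ^ 3 ≤ (1 + r) ^ 3 := by gcongr; linarith
  have hP : S * f ≤ (1 + S) * (1 + f) := by gcongr <;> linarith
  have hP1 : 1 ≤ (1 + S) * (1 + f) := one_le_mul_of_one_le_of_one_le (by linarith) (by linarith)
  have hP0 : 0 ≤ (1 + S) * (1 + f) := by linarith
  calc |correctionFactor a M b v|
      ≤ S * f * (K * r) + (K * r * (K * r) * (K * r) + d * (K * r * K)) := by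
        rw [abs_le] at h1 h2 h3 ⊢
        rw [correctionFactor]
        have : 0 ≤ K * r * (K * r) * (K * r) + d * (K * r * K) := by positivity
        constructor <;> linarith
    _ = S * f * (K * r) + 1 * (K ^ 3 * r ^ 3 + d * K ^ 2 * r) := by ring
    _ ≤ (1 + S) * (1 + f) * (K * (1 + r) ^ 3) +
        (1 + S) * (1 + f) * (K ^ 3 * (1 + r) ^ 3 + d * K ^ 2 * (1 + r) ^ 3) := by gcongr
    _ = _ := by ring

lemma abs_correctionFactor_sub_le {K S f η : ℝ} (hK : 0 ≤ K) (hS : 0 ≤ S) (hf : 0 ≤ f)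
    (hη : 0 ≤ η) {a a' M M' : Matrix (Fin d) (Fin d) ℝ} {b b' v : Ed d}
    (ha : ‖a⁻¹‖ ≤ K) (ha' : ‖a'⁻¹‖ ≤ K) (haa : ‖a⁻¹ - a'⁻¹‖ ≤ K ^ 3 * η)
    (hM' : ‖M'‖ ≤ K * ‖v‖) (hMM : ‖M - M'‖ ≤ K * ‖v‖ * η)
    (hb' : ‖b'‖ ≤ S * f) (hbb : ‖b - b'‖ ≤ η * f) :
    |correctionFactor a M b v - correctionFactor a' M' b' v| ≤
      (K + 2 * K ^ 3 + 2 * K ^ 5 + d * K ^ 2 + d * K ^ 4) * η * (1 + ‖v‖) ^ 3 *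
        ((1 + S) * (1 + f)) := by
  set r := ‖v‖ with hr
  have hr0 : 0 ≤ r := norm_nonneg v
  set u := toEuclideanLin a⁻¹ v with hu_def
  set u' := toEuclideanLin a'⁻¹ v with hu_def'
  have hu : ‖u‖ ≤ K * r := (norm_toEuclideanLin_le _ _).trans (by gcongr)
  have hu' : ‖u'‖ ≤ K * r := (norm_toEuclideanLin_le _ _).trans (by gcongr)
  have huu : ‖u - u'‖ ≤ K ^ 3 * η * r := by
    rw [hu_def, hu_def', ← LinearMap.sub_apply, ← map_sub]
    exact (norm_toEuclideanLin_le _ _).trans (by gcongr)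
  have h1 : |⟪b - b', u⟫| ≤ η * f * (K * r) :=
    (abs_real_inner_le_norm _ _).trans (by gcongr)
  have h2 : |⟪b', u - u'⟫| ≤ S * f * (K ^ 3 * η * r) :=
    (abs_real_inner_le_norm _ _).trans (by gcongr)
  have h3 : |⟪toEuclideanLin (M - M') u, u⟫| ≤ K * r * η * (K * r) * (K * r) :=
    (abs_inner_toEuclideanLin_le _ _ _).trans (by gcongr)
  have h4 : |⟪toEuclideanLin M' (u - u'), u⟫| ≤ K * r * (K ^ 3 * η * r) * (K * r) :=
    (abs_inner_toEuclideanLin_le _ _ _).trans (by gcongr)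
  have h5 : |⟪toEuclideanLin M' u', u - u'⟫| ≤ K * r * (K * r) * (K ^ 3 * η * r) :=
    (abs_inner_toEuclideanLin_le _ _ _).trans (by gcongr)
  have h6 : |((M - M') * a⁻¹).trace| ≤ d * (K * r * η * K) :=
    (abs_trace_le _).trans (by gcongr; exact (norm_mul_le _ _).trans (by gcongr))
  have h7 : |(M' * (a⁻¹ - a'⁻¹)).trace| ≤ d * (K * r * (K ^ 3 * η)) :=
    (abs_trace_le _).trans (by gcongr; exact (norm_mul_le _ _).trans (by gcongr))
  have hsplit : correctionFactor a M b v - correctionFactor a' M' b' v =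
      -⟪b - b', u⟫ - ⟪b', u - u'⟫ + 1 / 2 * (⟪toEuclideanLin (M - M') u, u⟫ +
        ⟪toEuclideanLin M' (u - u'), u⟫ + ⟪toEuclideanLin M' u', u - u'⟫ -
        ((M - M') * a⁻¹).trace - (M' * (a⁻¹ - a'⁻¹)).trace) := by
    rw [correctionFactor, correctionFactor, ← hu_def, ← hu_def']
    simp only [map_sub, LinearMap.sub_apply, inner_sub_left, inner_sub_right, sub_mul, mul_sub,
      Matrix.trace_sub]
    ring
  have hrle : r ≤ (1 + r) ^ 3 := le_one_add_pow_three hr0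
  have hr3 : r ^ 3 ≤ (1 + r) ^ 3 := by gcongr; linarith
  have hP : S * f ≤ (1 + S) * (1 + f) := by gcongr <;> linarith
  have hPf : f ≤ (1 + S) * (1 + f) := by
    linarith [mul_nonneg hS (by linarith : 0 ≤ 1 + f)]
  have hP1 : 1 ≤ (1 + S) * (1 + f) := one_le_mul_of_one_le_of_one_le (by linarith) (by linarith)
  have hP0 : 0 ≤ (1 + S) * (1 + f) := by linarith
  calc |correctionFactor a M b v - correctionFactor a' M' b' v|
      ≤ η * f * (K * r) + S * f * (K ^ 3 * η * r) + (K * r * η * (K * r) * (K * r) +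
          K * r * (K ^ 3 * η * r) * (K * r) + K * r * (K * r) * (K ^ 3 * η * r) +
          d * (K * r * η * K) + d * (K * r * (K ^ 3 * η))) := by
        have habs : ∀ x₁ x₂ t : ℝ, |-x₁ - x₂ + 1 / 2 * t| ≤ |x₁| + |x₂| + 1 / 2 * |t| := by
          intro x₁ x₂ t
          rw [← abs_neg x₁, ← abs_neg x₂, sub_eq_add_neg,
            ← abs_of_pos (one_half_pos : (0 : ℝ) < 1 / 2), ← abs_mul,
            abs_of_pos (one_half_pos : (0 : ℝ) < 1 / 2)]
          exact abs_add_three _ _ _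
        have habs' : ∀ x₁ x₂ x₃ x₄ x₅ : ℝ,
            |x₁ + x₂ + x₃ - x₄ - x₅| ≤ |x₁| + |x₂| + |x₃| + |x₄| + |x₅| := fun _ _ _ _ _ =>
          (abs_sub _ _).trans (add_le_add_left ((abs_sub _ _).trans
            (add_le_add_left (abs_add_three _ _ _) _)) _)
        rw [hsplit]
        refine (habs _ _ _).trans (add_le_add (add_le_add h1 h2) ?_)
        refine (mul_le_of_le_one_left (abs_nonneg _) (by norm_num)).trans ((habs' _ _ _ _ _).trans ?_)
        gcongr
    _ = f * (K * η * r) + S * f * (K ^ 3 * η * r) +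
        1 * (K ^ 3 * η * r ^ 3 + 2 * K ^ 5 * η * r ^ 3 + (d * K ^ 2 + d * K ^ 4) * η * r) := by
        ring
    _ ≤ (1 + S) * (1 + f) * (K * η * (1 + r) ^ 3) +
        (1 + S) * (1 + f) * (K ^ 3 * η * (1 + r) ^ 3) +
        (1 + S) * (1 + f) * (K ^ 3 * η * (1 + r) ^ 3 + 2 * K ^ 5 * η * (1 + r) ^ 3 +
          (d * K ^ 2 + d * K ^ 4) * η * (1 + r) ^ 3) := by gcongr
    _ = _ := by ring

lemma exists_pow_mul_exp_le {K : ℝ} (hK : 0 < K) : ∃ C : ℝ, 0 < C ∧ ∀ r : ℝ, 0 ≤ r →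
    (1 + r) ^ 5 * Real.exp (-(r ^ 2 / (2 * K))) ≤ C * Real.exp (-(r ^ 2 / (8 * K))) := by
  refine ⟨Nat.factorial 5 * Real.exp (1 + 2 * K / 3), by positivity, fun r hr => ?_⟩
  have h1 : (1 + r) ^ 5 ≤ Nat.factorial 5 * Real.exp (1 + r) := by
    have := Real.pow_div_factorial_le_exp (1 + r) (by linarith) 5
    rwa [div_le_iff₀' (by positivity)] at this
  have h2 : r ≤ 3 * (r ^ 2 / (8 * K)) + 2 * K / 3 := by
    have h : 3 * (r ^ 2 / (8 * K)) + 2 * K / 3 - r = (3 * r - 4 * K) ^ 2 / (24 * K) := by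
      field_simp; ring
    have : 0 ≤ (3 * r - 4 * K) ^ 2 / (24 * K) := by positivity
    linarith
  have h3 : r ^ 2 / (2 * K) = 4 * (r ^ 2 / (8 * K)) := by field_simp; ring
  calc _ ≤ Nat.factorial 5 * Real.exp (1 + r) * Real.exp (-(r ^ 2 / (2 * K))) := by gcongr
    _ = Nat.factorial 5 * Real.exp (1 + r + -(r ^ 2 / (2 * K))) := by rw [mul_assoc, ← Real.exp_add]
    _ ≤ Nat.factorial 5 * Real.exp (1 + 2 * K / 3 + -(r ^ 2 / (8 * K))) := by
        gcongr ?_ * Real.exp ?_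
        linarith
    _ = _ := by rw [mul_assoc, ← Real.exp_add]

/-- Stability of the rescaled correction kernel in its data. -/
lemma exists_scaled_correction_bound (d : ℕ) {K : ℝ} (hK : 1 ≤ K) : ∃ C : ℝ, 0 < C ∧
    ∀ (a a' M M' : Matrix (Fin d) (Fin d) ℝ) (b b' v : Ed d) (S f η : ℝ), 0 ≤ S → 0 ≤ f → 0 ≤ η →
      IsSymmElliptic K a → IsSymmElliptic K a' → ‖a - a'‖ ≤ K * η →
      ‖M'‖ ≤ K * ‖v‖ → ‖M - M'‖ ≤ K * ‖v‖ * η →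
      ‖b'‖ ≤ S * f → ‖b - b'‖ ≤ η * f →
      |gaussFactor a v * correctionFactor a M b v -
          gaussFactor a' v * correctionFactor a' M' b' v| ≤
        C * ((1 + S) * (1 + f)) * η * Real.exp (-(‖v‖ ^ 2 / (8 * K))) := by
  have hK0 : 0 < K := by linarith
  obtain ⟨C₁, hC₁, hgauss⟩ := exists_gaussFactor_bound d hK
  obtain ⟨C₂, hC₂, hpoly⟩ := exists_pow_mul_exp_le hK0
  set L := K + K ^ 3 + d * K ^ 2 with hL
  set L' := K + 2 * K ^ 3 + 2 * K ^ 5 + d * K ^ 2 + d * K ^ 4 with hL'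
  have hL0 : 0 < L := by positivity
  have hL0' : 0 < L' := by positivity
  refine ⟨C₁ * (L + L') * C₂, by positivity, ?_⟩
  intro a a' M M' b b' v S f η hS hf hη hell hell' haa hM' hMM hb' hbb
  obtain ⟨ha, -, hni, -⟩ := inverse_elliptic hK0 hell.1 hell.2
  obtain ⟨ha', -, hni', -⟩ := inverse_elliptic hK0 hell'.1 hell'.2
  have hG : ‖a⁻¹ - a'⁻¹‖ ≤ K ^ 3 * η := by
    calc _ ≤ K ^ 2 * ‖a - a'‖ := norm_inv_sub_inv_le hK0.le ha ha' hni hni'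
      _ ≤ K ^ 2 * (K * η) := by gcongr
      _ = K ^ 3 * η := by ring
  obtain ⟨hq, hqq⟩ := hgauss a a' η v hell hell' haa
  have hΦ' := abs_correctionFactor_le hK0.le hS hf hni' hM' hb'
  have hΦΦ := abs_correctionFactor_sub_le hK0.le hS hf hη hni hni' hG hM' hMM hb' hbb
  rw [← hL] at hΦ'
  rw [← hL'] at hΦΦ
  set P := (1 + S) * (1 + f) with hP
  have hP0 : 0 ≤ P := by positivity
  set g := Real.exp (-(‖v‖ ^ 2 / (2 * K))) with hg
  have hg0 : 0 < g := Real.exp_pos _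
  have hv := norm_nonneg v
  have hsplit : gaussFactor a v * correctionFactor a M b v -
      gaussFactor a' v * correctionFactor a' M' b' v =
      (gaussFactor a v - gaussFactor a' v) * correctionFactor a' M' b' v +
        gaussFactor a v * (correctionFactor a M b v - correctionFactor a' M' b' v) := by ring
  have hpow : (1 + ‖v‖) ^ 3 ≤ (1 + ‖v‖) ^ 5 :=
    pow_le_pow_right₀ (by linarith) (by norm_num)
  rw [hsplit]
  calc _ ≤ C₁ * η * (1 + ‖v‖) ^ 2 * g * (L * (1 + ‖v‖) ^ 3 * P) +
        C₁ * g * (L' * η * (1 + ‖v‖) ^ 3 * P) := by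
        refine (abs_add_le _ _).trans (add_le_add ?_ ?_)
        · rw [abs_mul]
          exact mul_le_mul hqq hΦ' (abs_nonneg _) (by positivity)
        · rw [abs_mul]
          exact mul_le_mul hq hΦΦ (abs_nonneg _) (by positivity)
    _ ≤ C₁ * η * (1 + ‖v‖) ^ 2 * g * (L * (1 + ‖v‖) ^ 3 * P) +
        C₁ * g * (L' * η * (1 + ‖v‖) ^ 5 * P) := by gcongr
    _ = C₁ * (L + L') * P * η * ((1 + ‖v‖) ^ 5 * g) := by ring
    _ ≤ C₁ * (L + L') * P * η * (C₂ * Real.exp (-(‖v‖ ^ 2 / (8 * K)))) := by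
        exact mul_le_mul_of_nonneg_left (hpoly _ hv) (by positivity)
    _ = _ := by ring

lemma gaussK_two_mul_eq {K τ : ℝ} (hK : 0 < K) (hτ : 0 < τ) (y z : Ed d) :
    gaussK d (2 * K) τ y z = (4 * K) ^ (-(d : ℝ) / 2) * (2 * Real.pi * τ) ^ (-(d : ℝ) / 2) *
      Real.exp (-(‖(√τ)⁻¹ • (z - y)‖ ^ 2 / (8 * K))) := by
  rw [gaussK, ← Real.mul_rpow (by positivity) (by positivity), norm_smul, mul_pow, norm_inv,
    Real.norm_of_nonneg (Real.sqrt_nonneg τ), inv_pow, Real.sq_sqrt hτ.le]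
  congr 2
  · ring
  · field_simp
    ring

end ScaledKernel

/-- the stability bound (A2) for the first-order correction kernels:
`|H(y,z) − H̃(y,z)| ≤ c (1+S)(1+f(y)) η τ^{-1/2} p̃^{2K,τ}(y,z)`, where `H, H̃` are
built from the data `(b, A)` and `(b̃, Ã)` respectively. -/
theorem stmt17 (d : ℕ) (hd : 1 ≤ d) (K : ℝ) (hK : 1 ≤ K) :
    ∃ c > 0, ∀ τ S η : ℝ, 0 < τ → 0 ≤ S → 0 ≤ η →
      ∀ A A' : Ed d → Matrix (Fin d) (Fin d) ℝ, Measurable A → Measurable A' →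
        (∀ x, (A x).IsSymm) → (∀ x, (A' x).IsSymm) →
        (∀ (x : Ed d) (ξ : Ed d),
          K⁻¹ * ‖ξ‖ ^ 2 ≤ ⟪Matrix.toEuclideanLin (A x) ξ, ξ⟫ ∧
            ⟪Matrix.toEuclideanLin (A x) ξ, ξ⟫ ≤ K * ‖ξ‖ ^ 2) →
        (∀ (x : Ed d) (ξ : Ed d),
          K⁻¹ * ‖ξ‖ ^ 2 ≤ ⟪Matrix.toEuclideanLin (A' x) ξ, ξ⟫ ∧
            ⟪Matrix.toEuclideanLin (A' x) ξ, ξ⟫ ≤ K * ‖ξ‖ ^ 2) →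
        (∀ x y : Ed d, opN (A x - A y) ≤ K * ‖x - y‖) →
        (∀ x y : Ed d, opN (A' x - A' y) ≤ K * ‖x - y‖) →
        (∀ x : Ed d, opN (A x - A' x) ≤ K * η) →
        (∀ y z : Ed d, opN ((A z - A y) - (A' z - A' y)) ≤ K * ‖z - y‖ * η) →
        ∀ f : Ed d → ℝ, Measurable f → (∀ y, 0 ≤ f y) →
          ∀ b b' : Ed d → Ed d, Measurable b → Measurable b' →
            (∀ y, ‖b y‖ ≤ S * f y) → (∀ y, ‖b' y‖ ≤ S * f y) →
            (∀ y, ‖b y - b' y‖ ≤ η * f y) →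
            ∀ y z : Ed d,
              |(-⟪b y, gradP d (τ • A z) z y⟫ +
                  (1 / 2) * Matrix.trace ((A z - A y) *
                    Matrix.of (fun i j =>
                      hessP d (τ • A z) z y (EuclideanSpace.single j (1 : ℝ)) i))) -
                (-⟪b' y, gradP d (τ • A' z) z y⟫ +
                  (1 / 2) * Matrix.trace ((A' z - A' y) *
                    Matrix.of (fun i j =>
                      hessP d (τ • A' z) z y (EuclideanSpace.single j (1 : ℝ)) i)))| ≤
                c * (1 + S) * (1 + f y) * η * τ ^ (-(1 : ℝ) / 2) *
                  gaussK d (2 * K) τ y z := by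
  have hK0 : 0 < K := by linarith
  obtain ⟨C, hC, hbound⟩ := exists_scaled_correction_bound d hK
  refine ⟨C * (4 * K) ^ ((d : ℝ) / 2), by positivity, ?_⟩
  intro τ S η hτ hS hη A A' _ _ hsym hsym' hell hell' _ hLip' hAA hdiff f _ hf b b' _ _ _ hb'
    hbb y z
  have hscale : ∀ x : Ed d, ‖(√τ)⁻¹ • x‖ = (√τ)⁻¹ * ‖x‖ := fun x => by
    rw [norm_smul, Real.norm_of_nonneg (by positivity)]
  have hscaleM : ∀ M : Matrix (Fin d) (Fin d) ℝ, ‖(√τ)⁻¹ • M‖ = (√τ)⁻¹ * ‖M‖ := fun M => by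
    rw [norm_smul, Real.norm_of_nonneg (by positivity)]
  set v : Ed d := (√τ)⁻¹ • (z - y) with hv
  have hM' : ‖(√τ)⁻¹ • (A' z - A' y)‖ ≤ K * ‖v‖ := by
    rw [hscaleM, hv, hscale, mul_left_comm]
    exact mul_le_mul_of_nonneg_left (hLip' z y) (by positivity)
  have hMM : ‖(√τ)⁻¹ • (A z - A y) - (√τ)⁻¹ • (A' z - A' y)‖ ≤ K * ‖v‖ * η := by
    rw [← smul_sub, hscaleM, hv, hscale]
    calc _ ≤ (√τ)⁻¹ * (K * ‖z - y‖ * η) :=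
          mul_le_mul_of_nonneg_left (hdiff y z) (by positivity)
      _ = _ := by ring
  have key := hbound (A z) (A' z) _ _ (b y) (b' y) v S (f y) η hS (hf y) hη ⟨hsym z, hell z⟩
    ⟨hsym' z, hell' z⟩ (hAA z) hM' hMM (hb' y) (hbb y)
  rw [correction_kernel_eq hτ (hsym z) (inverse_elliptic hK0 (hsym z) (hell z)).1,
    correction_kernel_eq hτ (hsym' z) (inverse_elliptic hK0 (hsym' z) (hell' z)).1, ← mul_sub,
    abs_mul, abs_of_nonneg (by positivity), gaussK_two_mul_eq hK0 hτ, ← hv]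
  have hpow : (4 * K) ^ ((d : ℝ) / 2) * (4 * K) ^ (-(d : ℝ) / 2) = 1 := by
    rw [← Real.rpow_add (by positivity), neg_div, add_neg_cancel, Real.rpow_zero]
  calc _ ≤ (2 * Real.pi * τ) ^ (-(d : ℝ) / 2) * τ ^ (-(1 : ℝ) / 2) *
        (C * ((1 + S) * (1 + f y)) * η * Real.exp (-(‖v‖ ^ 2 / (8 * K)))) := by gcongr
    _ = ((4 * K) ^ ((d : ℝ) / 2) * (4 * K) ^ (-(d : ℝ) / 2)) *
        ((2 * Real.pi * τ) ^ (-(d : ℝ) / 2) * τ ^ (-(1 : ℝ) / 2) *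
        (C * ((1 + S) * (1 + f y)) * η * Real.exp (-(‖v‖ ^ 2 / (8 * K))))) := by
        rw [hpow, one_mul]
    _ = _ := by ring
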